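/- Treated-arm score identity (term H₁ in the proof of Lemma 1): assume A ≤ R ℙ-almost surely; A is conditionally independent of Y(1) given σ(X) under ℙ; Y = Y(1) on the event {A = 1}; π(X) is a version of ℙ(R=1 ∣ σ(X)); e_S(X) is a version of ℙ(A=1 ∣ σ(X)) with e_S(X) ≥ δ ℙ-almost surely for some δ > 0; and m₁(X) is a version of 𝔼[Y ∣ X, A=1] under ℙ. Then for every bounded measurable g : ℝ × ℝ^p → ℝ with 𝔼[ g(Y(1), X) ∣ σ(X) ] = 0 almost surely, 𝔼[ (π(X)/q)·R·A·(Y − m₁(X))·g(Y, X)/e_S(X) ] = (1/q)·𝔼[ π(X)·Y(1)·g(Y(1), X) ]. -/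

import Mathlib

open MeasureTheory ProbabilityTheory


/-- `v ∘ X` is a version of `𝔼_Q[W ∣ X]` on the event where the (real-valued) indicator `ind`
equals one: for every bounded measurable `h : ℝ^p → ℝ`,
`𝔼_Q[ind · W · h(X)] = 𝔼_Q[ind · v(X) · h(X)]`.  Versions of conditional expectations
`𝔼_Q[Y ∣ X, A = a]` are obtained with `ind = 1{A=a}` and `W = Y`; versions of conditional
probabilities such as `Q(R=1 ∣ σ(X))` are obtained with `ind = 1` and `W = 1{R=1}`. -/
def IsCondVersion {Ω : Type*} [MeasurableSpace Ω] {p : ℕ} (Q : Measure Ω)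
    (X : Ω → Fin p → ℝ) (ind : Ω → ℝ) (W : Ω → ℝ) (v : (Fin p → ℝ) → ℝ) : Prop :=
  Measurable v ∧ ∀ h : (Fin p → ℝ) → ℝ, Measurable h → (∃ C, ∀ x, |h x| ≤ C) →
    ∫ ω, ind ω * W ω * h (X ω) ∂Q = ∫ ω, ind ω * v (X ω) * h (X ω) ∂Q


lemma version_eq {Ω : Type*} [MeasurableSpace Ω] {p : ℕ} (P : Measure Ω) [IsProbabilityMeasure P]
    (X : Ω → Fin p → ℝ) (hX : Measurable X) (ind W : Ω → ℝ) (v : (Fin p → ℝ) → ℝ)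
    (hind : Integrable ind P) (hW : Integrable (fun ω => ind ω * W ω) P)
    (hv : IsCondVersion P X ind W v) :
    P[fun ω => ind ω * W ω | MeasurableSpace.comap X inferInstance] =ᵐ[P]
      fun ω => v (X ω) * (P[ind | MeasurableSpace.comap X inferInstance]) ω := by
  obtain ⟨hvm, hv⟩ := hv
  have hm := hX.comap_le
  have hXm : Measurable[MeasurableSpace.comap X inferInstance] X := comap_measurable X
  let k : ℕ → (Fin p → ℝ) → ℝ := fun n => Set.indicator {x | |v x| ≤ n} 1
  have hset : ∀ n : ℕ, MeasurableSet {x | |v x| ≤ n} := fun n =>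
    measurableSet_le (by fun_prop) measurable_const
  have hk : ∀ n, Measurable (k n) := fun n => measurable_one.indicator (hset n)
  have hkb : ∀ n x, |k n x| ≤ 1 := by
    intro n x
    by_cases h : x ∈ {x | |v x| ≤ n} <;> simp [k, Set.indicator, h]
  have hkv : ∀ n x, |k n x * v x| ≤ n := by
    intro n x
    by_cases h : |v x| ≤ n
    · simpa [k, Set.indicator, h] using h
    · simp [k, Set.indicator, h]
  have key : ∀ n, ∀ᵐ ω ∂P,
      k n (X ω) * (P[fun ω => ind ω * W ω | MeasurableSpace.comap X inferInstance]) ω =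
      (k n (X ω) * v (X ω)) * (P[ind | MeasurableSpace.comap X inferInstance]) ω := by
    intro n
    have s1 : StronglyMeasurable[MeasurableSpace.comap X inferInstance] (fun ω => k n (X ω)) :=
      ((hk n).comp hXm).stronglyMeasurable
    have s2 : StronglyMeasurable[MeasurableSpace.comap X inferInstance]
        (fun ω => k n (X ω) * v (X ω)) :=
      (((hk n).mul hvm).comp hXm).stronglyMeasurable
    have e1 := condExp_stronglyMeasurable_mul_of_bound hm s1 hW 1 (.of_forall fun ω => hkb n (X ω))
    have e2 := condExp_stronglyMeasurable_mul_of_bound hm s2 hind n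
      (.of_forall fun ω => hkv n (X ω))
    have i1 : Integrable ((fun ω => k n (X ω)) * (fun ω => ind ω * W ω)) P :=
      hW.bdd_mul (s1.mono hm).aestronglyMeasurable (.of_forall fun ω => hkb n (X ω))
    have i2 : Integrable ((fun ω => k n (X ω) * v (X ω)) * ind) P :=
      hind.bdd_mul (s2.mono hm).aestronglyMeasurable (.of_forall fun ω => hkv n (X ω))
    have e3 := ae_eq_condExp_of_forall_setIntegral_eq hm i2
      (g := P[(fun ω => k n (X ω)) * (fun ω => ind ω * W ω) |
        MeasurableSpace.comap X inferInstance])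
      (fun s _ _ => integrable_condExp.integrableOn) (by
        rintro s ⟨B, hB, rfl⟩ -
        rw [setIntegral_condExp hm i1 ⟨B, hB, rfl⟩]
        rw [← integral_indicator (hX hB), ← integral_indicator (hX hB)]
        have := hv (fun x => B.indicator 1 x * k n x)
          ((measurable_one.indicator hB).mul (hk n)) ⟨1, fun x => by
            by_cases h : x ∈ B
            · simpa [h] using hkb n x
            · simp [h]⟩
        convert this using 2
        · ext ω
          by_cases h : X ω ∈ B
          · simp [h]; ring
          · simp [h]
        · ext ω
          by_cases h : X ω ∈ B
          · simp [h]; ring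
          · simp [h])
      stronglyMeasurable_condExp.aestronglyMeasurable
    filter_upwards [e1, e2, e3] with ω h1 h2 h3
    rw [h1, h2] at h3
    exact h3
  filter_upwards [ae_all_iff.2 key] with ω h
  obtain ⟨n, hn⟩ := exists_nat_ge |v (X ω)|
  simpa [k, Set.indicator, hn] using h n

lemma integral_pull {Ω : Type*} {m m0 : MeasurableSpace Ω} (hm : m ≤ m0) (P : Measure Ω)
    [IsProbabilityMeasure P] (u f : Ω → ℝ) (hu : StronglyMeasurable[m] u) (hf : Integrable f P)
    (huf : Integrable (fun ω => u ω * f ω) P) :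
    ∫ ω, u ω * f ω ∂P = ∫ ω, u ω * (P[f | m]) ω ∂P := by
  rw [← integral_condExp hm]
  exact integral_congr_ae (condExp_mul_of_stronglyMeasurable_left hu huf hf)

lemma condIndep_condExp {Ω : Type*} [MeasurableSpace Ω] [StandardBorelSpace Ω]
    (P : Measure Ω) [IsProbabilityMeasure P] {p : ℕ}
    (X : Ω → Fin p → ℝ) (hX : Measurable X) (A Y1 : Ω → ℝ) (hA : Measurable A)
    (hAi : Integrable A P) (hY1m : Measurable Y1)
    (hCI : CondIndepFun (MeasurableSpace.comap X inferInstance) hX.comap_le A Y1 P) :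
    P[A | MeasurableSpace.comap (fun ω => (X ω, Y1 ω)) inferInstance] =ᵐ[P]
      P[A | MeasurableSpace.comap X inferInstance] := by
  have h := (condIndepFun_iff_condDistrib_prod_ae_eq_prodMkRight hA hY1m hX).1 hCI.symm
  have h' := ae_of_ae_map (hX.prodMk hY1m).aemeasurable h
  filter_upwards [h', condExp_ae_eq_integral_condDistrib' (hX.prodMk hY1m) hAi,
    condExp_ae_eq_integral_condDistrib' hX hAi] with ω h1 h2 h3
  rw [h2, h3, h1]
  simp

/-- Treated-arm score identity (term `H₁` in the proof of Lemma 1). -/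
theorem treated_arm_score_identity {Ω : Type*} [MeasurableSpace Ω] [StandardBorelSpace Ω]
    [Nonempty Ω]
    (P : Measure Ω) [IsProbabilityMeasure P]
    (p : ℕ) (hp : 1 ≤ p)
    (X : Ω → Fin p → ℝ) (hX : Measurable X)
    (A R : Ω → ℝ) (hA : Measurable A) (hR : Measurable R)
    (hA01 : ∀ ω, A ω = 0 ∨ A ω = 1) (hR01 : ∀ ω, R ω = 0 ∨ R ω = 1)
    -- external-control units are never treated
    (hAR : ∀ᵐ ω ∂P, A ω ≤ R ω)
    (Y0 Y1 : Ω → ℝ) (hY0m : Measurable Y0) (hY1m : Measurable Y1)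
    (hY0 : Integrable Y0 P) (hY1 : Integrable Y1 P)
    (Y : Ω → ℝ) (hY : ∀ ω, Y ω = A ω * Y1 ω + (1 - A ω) * Y0 ω)
    (q : ℝ) (hq : P {ω | R ω = 1} = ENNReal.ofReal q) (hq0 : 0 < q) (hq1 : q < 1)
    -- A ⫫ Y(1) ∣ σ(X) under P
    (hCI : CondIndepFun (MeasurableSpace.comap X inferInstance) hX.comap_le A Y1 P)
    -- Y = Y(1) on the event {A = 1}
    (hYA1 : ∀ ω, A ω = 1 → Y ω = Y1 ω)
    -- π is a version of P(R=1 ∣ σ(X)); e_S a version of P(A=1 ∣ σ(X)) with e_S ≥ δ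
    (π : (Fin p → ℝ) → ℝ) (hπ : IsCondVersion P X (fun _ => 1) R π)
    (eS : (Fin p → ℝ) → ℝ) (heS : IsCondVersion P X (fun _ => 1) A eS)
    (δ : ℝ) (hδ : 0 < δ) (heSbd : ∀ᵐ ω ∂P, δ ≤ eS (X ω))
    -- m₁ is a version of 𝔼[Y ∣ X, A=1] under P
    (m₁ : (Fin p → ℝ) → ℝ) (hm₁ : IsCondVersion P X A Y m₁) :
    ∀ g : ℝ × (Fin p → ℝ) → ℝ, Measurable g → (∃ C, ∀ z, |g z| ≤ C) →
      (P[fun ω => g (Y1 ω, X ω)|MeasurableSpace.comap X inferInstance] =ᵐ[P] 0) →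
      ∫ ω, π (X ω) / q * (R ω * A ω * (Y ω - m₁ (X ω)) * g (Y ω, X ω) / eS (X ω)) ∂P =
        (1 / q) * ∫ ω, π (X ω) * Y1 ω * g (Y1 ω, X ω) ∂P := by
  rintro g hg ⟨C, hC⟩ hg0
  have hm := hX.comap_le
  have hXm : Measurable[MeasurableSpace.comap X inferInstance] X := comap_measurable X
  have hAb : ∀ ω, ‖A ω‖ ≤ 1 := fun ω => by rcases hA01 ω with h | h <;> simp [h]
  have hRb : ∀ ω, ‖R ω‖ ≤ 1 := fun ω => by rcases hR01 ω with h | h <;> simp [h]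
  have hAi : Integrable A P := .of_bound hA.aestronglyMeasurable 1 (.of_forall hAb)
  have hRi : Integrable R P := .of_bound hR.aestronglyMeasurable 1 (.of_forall hRb)
  have hAY : (fun ω => A ω * Y ω) = fun ω => A ω * Y1 ω := by
    ext ω
    rcases hA01 ω with h | h
    · simp [h]
    · rw [hYA1 ω h]
  have hAYi : Integrable (fun ω => A ω * Y ω) P := by
    rw [hAY]
    exact hY1.bdd_mul hA.aestronglyMeasurable (.of_forall hAb)
  have one : P[(fun _ => (1 : ℝ)) | MeasurableSpace.comap X inferInstance] = fun _ => 1 :=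
    condExp_const hm 1
  have vA := version_eq P X hX _ _ _ (integrable_const 1) (by simpa using hAi) heS
  have vR := version_eq P X hX _ _ _ (integrable_const 1) (by simpa using hRi) hπ
  have vY := version_eq P X hX _ _ _ hAi hAYi hm₁
  simp only [one, one_mul, mul_one] at vA vR
  have hπb : ∀ᵐ ω ∂P, ‖π (X ω)‖ ≤ 1 := by
    have h0 : 0 ≤ᵐ[P] P[R | MeasurableSpace.comap X inferInstance] :=
      condExp_nonneg (.of_forall fun ω => by rcases hR01 ω with h | h <;> simp [h])
    have h1 : P[R | MeasurableSpace.comap X inferInstance] ≤ᵐ[P]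
        P[(fun _ => (1 : ℝ)) | MeasurableSpace.comap X inferInstance] :=
      condExp_mono hRi (integrable_const _)
        (.of_forall fun ω => by rcases hR01 ω with h | h <;> simp [h])
    rw [one] at h1
    filter_upwards [h0, h1, vR] with ω a b c
    have a' : (0 : ℝ) ≤ (P[R | MeasurableSpace.comap X inferInstance]) ω := a
    rw [c] at a' b
    rw [Real.norm_eq_abs, abs_le]
    constructor <;> linarith
  have hπm := hπ.1
  have hem := heS.1
  have hmm := hm₁.1
  -- bounded inverse of eS
  have heb : ∀ᵐ ω ∂P, ‖(eS (X ω))⁻¹‖ ≤ δ⁻¹ := by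
    filter_upwards [heSbd] with ω h
    rw [norm_inv, Real.norm_eq_abs, abs_of_pos (hδ.trans_le h)]
    exact inv_anti₀ hδ h
  have hm1i : Integrable (fun ω => m₁ (X ω)) P := by
    have : Integrable (fun ω => (eS (X ω))⁻¹ *
        (P[fun ω => A ω * Y ω | MeasurableSpace.comap X inferInstance]) ω) P :=
      integrable_condExp.bdd_mul (hem.comp hX).inv.aestronglyMeasurable heb
    refine this.congr ?_
    filter_upwards [vA, vY, heSbd] with ω a b c
    have : eS (X ω) ≠ 0 := (hδ.trans_le c).ne'
    rw [b, a]
    field_simp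
  have hgb : ∀ᵐ ω ∂P, ‖g (Y1 ω, X ω)‖ ≤ C := .of_forall fun ω => hC _
  have hgm : Measurable fun ω => g (Y1 ω, X ω) := hg.comp (hY1m.prodMk hX)
  have hgi : Integrable (fun ω => g (Y1 ω, X ω)) P := .of_bound hgm.aestronglyMeasurable C hgb
  have i1 : Integrable (fun ω => π (X ω) * Y1 ω * g (Y1 ω, X ω)) P :=
    (hY1.bdd_mul (hπm.comp hX).aestronglyMeasurable hπb).mul_bdd hgm.aestronglyMeasurable hgb
  have i2 : Integrable (fun ω => π (X ω) * m₁ (X ω) * g (Y1 ω, X ω)) P :=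
    (hm1i.bdd_mul (hπm.comp hX).aestronglyMeasurable hπb).mul_bdd hgm.aestronglyMeasurable hgb
  have z : ∫ ω, π (X ω) * m₁ (X ω) * g (Y1 ω, X ω) ∂P = 0 := by
    rw [integral_pull hm P (fun ω => π (X ω) * m₁ (X ω)) (fun ω => g (Y1 ω, X ω))
      ((hπm.mul hmm).comp hXm).stronglyMeasurable hgi i2]
    apply integral_eq_zero_of_ae
    filter_upwards [hg0] with ω h
    simp [h]
  have iD : Integrable (fun ω => π (X ω) * (Y1 ω - m₁ (X ω)) * g (Y1 ω, X ω)) P := by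
    refine (i1.sub i2).congr (.of_forall fun ω => ?_)
    simp only [Pi.sub_apply]; ring
  let Φ : Ω → ℝ := fun ω => (eS (X ω))⁻¹ * (π (X ω) * (Y1 ω - m₁ (X ω)) * g (Y1 ω, X ω))
  have iΦ : Integrable Φ P := iD.bdd_mul (hem.comp hX).inv.aestronglyMeasurable heb
  have hΦm : StronglyMeasurable[MeasurableSpace.comap (fun ω => (X ω, Y1 ω)) inferInstance] Φ := by
    have : Measurable fun z : (Fin p → ℝ) × ℝ =>
        (eS z.1)⁻¹ * (π z.1 * (z.2 - m₁ z.1) * g (z.2, z.1)) := by fun_prop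
    exact (this.comp (comap_measurable (fun ω => (X ω, Y1 ω)))).stronglyMeasurable
  have main : ∫ ω, Φ ω * A ω ∂P = ∫ ω, π (X ω) * Y1 ω * g (Y1 ω, X ω) ∂P := by
    rw [integral_pull (hX.prodMk hY1m).comap_le P Φ A hΦm hAi
      (iΦ.mul_bdd hA.aestronglyMeasurable (.of_forall hAb))]
    rw [← sub_zero (∫ ω, π (X ω) * Y1 ω * g (Y1 ω, X ω) ∂P), ← z, ← integral_sub i1 i2]
    apply integral_congr_ae
    filter_upwards [vA, heSbd, condIndep_condExp P X hX A Y1 hA hAi hY1m hCI] with ω a b c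
    have : eS (X ω) ≠ 0 := (hδ.trans_le b).ne'
    rw [c, a]
    simp only [Φ]
    field_simp
  rw [← main, ← integral_const_mul]
  apply integral_congr_ae
  filter_upwards [hAR] with ω h
  simp only [Φ]
  rcases hA01 ω with h0 | h1
  · simp [h0]
  · have hR1 : R ω = 1 := by
      rcases hR01 ω with h2 | h2
      · rw [h1, h2] at h; linarith
      · exact h2
    rw [hYA1 ω h1, h1, hR1]
    ring
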